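/- arXiv:2408.11568 — 2 statements merged into one kernel-verified Lean document; each statement's English description precedes it below -/
import Mathlib

section
/- Let μ > 0, p ≥ 1 and 0 ≤ δ < 1 satisfy (p-1)/(μ(μ+√(1+μ²))) ≤ 1-δ. Then for all real numbers x, y: μ(2p-1-δ)x² + μ(1-δ)y² - 2(p-1)xy ≥ 0. -/
/-!
STATEMENT 8: Let μ > 0, p ≥ 1 and 0 ≤ δ < 1 satisfy (p-1)/(μ(μ+√(1+μ²))) ≤ 1-δ.
Then for all real x, y: μ(2p-1-δ)x² + μ(1-δ)y² - 2(p-1)xy ≥ 0.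
-/
theorem quadratic_form_nonneg (μ p δ : ℝ) (hμ : 0 < μ) (hp : 1 ≤ p)
    (hδ0 : 0 ≤ δ) (hδ1 : δ < 1)
    (hcond : (p - 1) / (μ * (μ + Real.sqrt (1 + μ ^ 2))) ≤ 1 - δ) :
    ∀ x y : ℝ,
      0 ≤ μ * (2 * p - 1 - δ) * x ^ 2 + μ * (1 - δ) * y ^ 2 - 2 * (p - 1) * x * y := by
  intro x y
  have hs2 : Real.sqrt (1 + μ ^ 2) ^ 2 = 1 + μ ^ 2 := Real.sq_sqrt (by positivity)
  have hsμ : μ ≤ Real.sqrt (1 + μ ^ 2) := Real.le_sqrt_of_sq_le (by linarith)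
  have hpos : 0 < μ * (μ + Real.sqrt (1 + μ ^ 2)) := by positivity
  rw [div_le_iff₀ hpos] at hcond
  generalize Real.sqrt (1 + μ ^ 2) = s at *
  have he : 0 < 1 - δ := by linarith
  have h2 : 0 ≤ (p - 1) + (1 - δ) * μ * (s - μ) := by
    have := mul_nonneg (mul_pos he hμ).le (sub_nonneg.2 hsμ)
    linarith
  have h3 := mul_nonneg (sub_nonneg.2 hcond) h2
  have hdisc : 0 ≤ μ ^ 2 * (1 - δ) * (2 * p - 1 - δ) - (p - 1) ^ 2 := by
    have e : μ ^ 2 * (1 - δ) * (2 * p - 1 - δ) - (p - 1) ^ 2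
        = ((1 - δ) * (μ * (μ + s)) - (p - 1)) * ((p - 1) + (1 - δ) * μ * (s - μ)) := by
      linear_combination (-(1 - δ) ^ 2 * μ ^ 2) * hs2
    rw [e]; exact h3
  have hC : 0 < μ * (1 - δ) := mul_pos hμ he
  refine nonneg_of_mul_nonneg_right (b := _) (a := μ * (1 - δ)) ?_ hC
  have := mul_nonneg hdisc (sq_nonneg x)
  have h4 := sq_nonneg (μ * (1 - δ) * y - (p - 1) * x)
  linarith
end

section
/- Let μ > 0, p ≥ 1 and 0 ≤ δ < 1 satisfy (p-1)/(μ(μ+√(1+μ²))) ≤ 1-δ. Then for every continuously differentiable v : 𝕋² → ℂ, δμ ∫_{𝕋²} |∇v|² |v|^{2p-2} dx ≤ Re[(i+μ) ∫_{𝕋²} ∇{(v conj(v))^{p-1} conj(v)} · ∇v dx]. -/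
/-!
STATEMENT 9: Let μ > 0, p ≥ 1 and 0 ≤ δ < 1 satisfy (p-1)/(μ(μ+√(1+μ²))) ≤ 1-δ.
Then for every continuously differentiable v : 𝕋² → ℂ,
δμ ∫_{𝕋²} |∇v|² |v|^{2p-2} dx ≤ Re[(i+μ) ∫_{𝕋²} ∇{(v conj v)^{p-1} conj v} · ∇v dx].

Functions on `𝕋²` are modeled as (1,1)-periodic functions on `V = ℝ × ℝ`, the integral over
`𝕋²` being the integral over the fundamental domain `[0,1]²`.
-/

noncomputable section

open MeasureTheory Complex Set

/-- Points of the two-dimensional torus, modeled by `ℝ × ℝ`. -/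
abbrev V : Type := ℝ × ℝ

/-- A fundamental domain `[0,1]²` for the torus `𝕋² = ℝ²/ℤ²`. -/
def TT : Set V := Set.Icc ((0:ℝ), (0:ℝ)) (1, 1)

/-- First partial derivative. -/
def D1 (f : V → ℂ) (x : V) : ℂ := fderiv ℝ f x (1, 0)

/-- Second partial derivative. -/
def D2 (f : V → ℂ) (x : V) : ℂ := fderiv ℝ f x (0, 1)

/-- The function `(v conj v)^{p-1} conj v = |v|^{2p-2} conj v`. -/
def Wp (p : ℝ) (f : V → ℂ) (y : V) : ℂ :=
  ((Complex.normSq (f y) ^ (p - 1) : ℝ) : ℂ) * (starRingEnd ℂ) (f y)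

/-- `∫_{𝕋²} |∇f|² |f|^{2p-2} dx`. -/
def GradTerm (p : ℝ) (f : V → ℂ) : ℝ :=
  ∫ x in TT, (‖D1 f x‖ ^ 2 + ‖D2 f x‖ ^ 2) * Complex.normSq (f x) ^ (p - 1)

/-- `∫_{𝕋²} ∇{(f conj f)^{p-1} conj f} · ∇f dx` (no complex conjugation in the pairing). -/
def GradPair (p : ℝ) (f : V → ℂ) : ℂ :=
  ∫ x in TT, (D1 (Wp p f) x * D1 f x + D2 (Wp p f) x * D2 f x)

def wform (p : ℝ) (z d : ℂ) : ℂ :=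
  ((Complex.normSq z ^ (p - 1) : ℝ) : ℂ) * (starRingEnd ℂ) d +
    ((2 * (p - 1) * Complex.normSq z ^ (p - 2) * (z.re * d.re + z.im * d.im) : ℝ) : ℂ) *
      (starRingEnd ℂ) z

theorem fderiv_normSq' (z : ℂ) : HasFDerivAt (fun w : ℂ => Complex.normSq w)
    ((2 * z.re) • Complex.reCLM + (2 * z.im) • Complex.imCLM) z := by
  have h1 : HasFDerivAt (fun w : ℂ => w.re) Complex.reCLM z := Complex.reCLM.hasFDerivAt
  have h2 : HasFDerivAt (fun w : ℂ => w.im) Complex.imCLM z := Complex.imCLM.hasFDerivAt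
  have h := (h1.mul h1).add (h2.mul h2)
  have e : (fun w : ℂ => Complex.normSq w) = fun w : ℂ => w.re * w.re + w.im * w.im := by
    funext w; exact Complex.normSq_apply w
  rw [e]
  refine h.congr_fderiv ?_
  ext <;> simp <;> ring

theorem fderiv_Wp (p : ℝ) (hp : 1 ≤ p) (f : V → ℂ) (x e : V) (hf : DifferentiableAt ℝ f x) :
    fderiv ℝ (Wp p f) x e = wform p (f x) (fderiv ℝ f x e) := by
  have hconj : HasFDerivAt (fun y => (starRingEnd ℂ) (f y))
      ((Complex.conjCLE : ℂ →L[ℝ] ℂ).comp (fderiv ℝ f x)) x :=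
    ((Complex.conjCLE : ℂ →L[ℝ] ℂ).hasFDerivAt (x := f x)).comp x hf.hasFDerivAt
  by_cases hz : f x = 0
  · rcases hp.eq_or_lt with h1 | h1
    · subst h1
      have : Wp 1 f = fun y => (starRingEnd ℂ) (f y) := by
        funext y; simp [Wp]
      rw [this, hconj.fderiv]
      simp [wform, hz]
    · have h0 : HasFDerivAt (Wp p f) (0 : V →L[ℝ] ℂ) x := by
        rw [hasFDerivAt_iff_isLittleO]
        have hO : (fun y => f y) =O[nhds x] fun y => y - x := by
          have := hf.hasFDerivAt.isBigO_sub
          simpa [hz] using this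
        have ho : (fun y => ((Complex.normSq (f y) ^ (p - 1) : ℝ) : ℂ)) =o[nhds x]
            (fun _ => (1:ℝ)) := by
          rw [Asymptotics.isLittleO_one_iff]
          have hc : ContinuousAt (fun y => ((Complex.normSq (f y) ^ (p - 1) : ℝ) : ℂ)) x := by
            refine Complex.continuous_ofReal.continuousAt.comp ?_
            refine ContinuousAt.rpow_const ?_ (Or.inr (by linarith))
            exact Complex.continuous_normSq.continuousAt.comp hf.continuousAt
          have := hc.tendsto
          simpa [hz, Real.zero_rpow (by linarith : p - 1 ≠ 0)] using this
        have hO' : (fun y => (starRingEnd ℂ) (f y)) =O[nhds x] fun y => ‖y - x‖ := by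
          refine Asymptotics.IsBigO.norm_right (Asymptotics.IsBigO.of_norm_left ?_)
          simpa using hO.norm_left
        have := (ho.mul_isBigO hO')
        simp only [one_mul] at this
        have h2 := this.of_norm_right
        refine h2.congr_left ?_
        intro y
        simp [Wp, hz]
      rw [h0.fderiv]
      simp [wform, hz, Real.zero_rpow (by linarith : p - 1 ≠ 0)]
  · have hs : Complex.normSq (f x) ≠ 0 := by simpa using hz
    have hn := (fderiv_normSq' (f x)).comp x hf.hasFDerivAt
    have hr := hn.rpow_const (p := p - 1) (Or.inl hs)
    have hR := (Complex.ofRealCLM.hasFDerivAt (x := Complex.normSq (f x) ^ (p-1))).comp x hr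
    have hm := hR.mul hconj
    have : HasFDerivAt (Wp p f) _ x := hm
    rw [this.fderiv]
    simp [wform, show p - 1 - 1 = p - 2 by ring]
    ring

theorem rpow_rel (p : ℝ) (z : ℂ) (hz : z ≠ 0) :
    Complex.normSq z ^ (p - 1) = Complex.normSq z ^ (p - 2) * Complex.normSq z := by
  have hs : 0 < Complex.normSq z := Complex.normSq_pos.2 hz
  rw [show p - 1 = (p - 2) + 1 by ring, Real.rpow_add hs, Real.rpow_one]

theorem quad_nonneg (μ q ε X Y : ℝ) (hμ : 0 < μ) (hq : 0 ≤ q) (hε : 0 < ε)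
    (h : q / (μ * (μ + Real.sqrt (1 + μ ^ 2))) ≤ ε) :
    0 ≤ μ * (2 * q + ε) * X ^ 2 + μ * ε * Y ^ 2 - 2 * q * X * Y := by
  have hr : 0 ≤ Real.sqrt (1 + μ ^ 2) := Real.sqrt_nonneg _
  have hr2 : Real.sqrt (1 + μ ^ 2) ^ 2 = 1 + μ ^ 2 := Real.sq_sqrt (by positivity)
  set r := Real.sqrt (1 + μ ^ 2)
  have hrμ : μ ≤ r := by nlinarith
  rw [div_le_iff₀ (by positivity)] at h
  have hd : q ^ 2 ≤ μ ^ 2 * ε * (2 * q + ε) := by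
    have h3 : 0 ≤ q + ε * (μ * (r - μ)) := by
      have : 0 ≤ r - μ := by linarith
      positivity
    have h4 := mul_nonneg (sub_nonneg.2 h) h3
    have h5 : (ε * (μ * (μ + r)) - q) * (q + ε * (μ * (r - μ)))
        = μ ^ 2 * ε * (2 * q) + ε ^ 2 * μ ^ 2 * (r ^ 2 - μ ^ 2) - q ^ 2 := by ring
    rw [h5, hr2] at h4
    nlinarith
  have hk : 0 < μ * ε := by positivity
  have : 0 ≤ (μ * ε) * (μ * (2 * q + ε) * X ^ 2 + μ * ε * Y ^ 2 - 2 * q * X * Y) := by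
    have : (μ * ε) * (μ * (2 * q + ε) * X ^ 2 + μ * ε * Y ^ 2 - 2 * q * X * Y)
      = (μ * ε * Y - q * X) ^ 2 + (μ ^ 2 * ε * (2 * q + ε) - q ^ 2) * X ^ 2 := by ring
    rw [this]
    have := sub_nonneg.2 hd
    positivity
  exact nonneg_of_mul_nonneg_right this hk

theorem pointwise (μ p δ : ℝ) (hμ : 0 < μ) (hp : 1 ≤ p) (hδ1 : δ < 1)
    (hcond : (p - 1) / (μ * (μ + Real.sqrt (1 + μ ^ 2))) ≤ 1 - δ) (z d : ℂ) :
    δ * μ * (‖d‖ ^ 2 * Complex.normSq z ^ (p - 1)) ≤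
      ((Complex.I + (μ : ℂ)) * (wform p z d * d)).re := by
  have hn : ‖d‖ ^ 2 = d.re ^ 2 + d.im ^ 2 := by
    rw [← Complex.normSq_eq_norm_sq, Complex.normSq_apply]; ring
  by_cases hz : z = 0
  · have ht : 0 ≤ Complex.normSq z ^ (p - 1) := Real.rpow_nonneg (Complex.normSq_nonneg _) _
    simp only [wform, hz] at *
    rw [hn]
    generalize (Complex.normSq 0 ^ (p - 1) : ℝ) = t at *
    simp
    have : 0 ≤ (1 - δ) * (μ * t * (d.re ^ 2 + d.im ^ 2)) := by
      have : 0 ≤ 1 - δ := by linarith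
      positivity
    nlinarith
  · have hq := quad_nonneg μ (p - 1) (1 - δ) (z.re * d.re + z.im * d.im)
      (z.re * d.im - z.im * d.re) hμ (by linarith) (by linarith) hcond
    have ht : 0 ≤ Complex.normSq z ^ (p - 2) := Real.rpow_nonneg (Complex.normSq_nonneg _) _
    rw [wform, rpow_rel p z hz, hn]
    generalize (Complex.normSq z ^ (p - 2) : ℝ) = t at *
    have := mul_nonneg ht hq
    rw [← sub_nonneg]
    refine this.trans_eq ?_
    simp [Complex.normSq_apply]
    ring

theorem wform_bound (p : ℝ) (hp : 1 ≤ p) (z d : ℂ) :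
    ‖wform p z d * d‖ ≤ (2 * p - 1) * (‖d‖ ^ 2 * Complex.normSq z ^ (p - 1)) := by
  have ht : 0 ≤ Complex.normSq z ^ (p - 1) := Real.rpow_nonneg (Complex.normSq_nonneg _) _
  have ht2 : 0 ≤ Complex.normSq z ^ (p - 2) := Real.rpow_nonneg (Complex.normSq_nonneg _) _
  have h1 : Complex.normSq z ^ (p - 2) * ‖z‖ ^ 2 ≤ Complex.normSq z ^ (p - 1) := by
    by_cases hz : z = 0
    · subst hz; simpa using ht
    · rw [rpow_rel p z hz, Complex.normSq_eq_norm_sq]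
  have h2 : |z.re * d.re + z.im * d.im| ≤ ‖z‖ * ‖d‖ := by
    have := Complex.abs_re_le_norm ((starRingEnd ℂ) z * d)
    simpa using this
  have h3 : ‖wform p z d‖ ≤ (2 * p - 1) * (‖d‖ * Complex.normSq z ^ (p - 1)) := by
    unfold wform
    refine (norm_add_le _ _).trans ?_
    simp only [norm_mul, Complex.norm_real, RCLike.norm_conj, Real.norm_eq_abs, abs_mul,
      abs_of_nonneg ht, abs_of_nonneg ht2, abs_of_nonneg (sub_nonneg.2 hp), abs_two]
    have hq := sub_nonneg.2 hp
    have : 2 * (p - 1) * Complex.normSq z ^ (p - 2) * |z.re * d.re + z.im * d.im| * ‖z‖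
        ≤ 2 * (p - 1) * Complex.normSq z ^ (p - 2) * (‖z‖ * ‖d‖) * ‖z‖ := by gcongr
    have h4 : 2 * (p - 1) * ‖d‖ * (Complex.normSq z ^ (p - 2) * ‖z‖ ^ 2) ≤
      2 * (p - 1) * ‖d‖ * Complex.normSq z ^ (p - 1) := by gcongr
    nlinarith
  rw [norm_mul]
  have := mul_le_mul_of_nonneg_right h3 (norm_nonneg d)
  nlinarith

theorem gradient_energy_lower_bound
    (μ p δ : ℝ) (hμ : 0 < μ) (hp : 1 ≤ p) (hδ0 : 0 ≤ δ) (hδ1 : δ < 1)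
    (hcond : (p - 1) / (μ * (μ + Real.sqrt (1 + μ ^ 2))) ≤ 1 - δ)
    (v : V → ℂ) (hv : ContDiff ℝ 1 v)
    (hper₁ : ∀ x : V, v (x.1 + 1, x.2) = v x)
    (hper₂ : ∀ x : V, v (x.1, x.2 + 1) = v x) :
    δ * μ * GradTerm p v ≤ ((Complex.I + (μ : ℂ)) * GradPair p v).re := by
  have hdiff : ∀ x, DifferentiableAt ℝ v x := fun x => (hv.differentiable (by simp)) x
  have hW : ∀ x e, fderiv ℝ (Wp p v) x e = wform p (v x) (fderiv ℝ v x e) :=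
    fun x e => fderiv_Wp p hp v x e (hdiff x)
  have hcf : Continuous (fderiv ℝ v) := hv.continuous_fderiv (by simp)
  have hc1 : Continuous (D1 v) := hcf.clm_apply continuous_const
  have hc2 : Continuous (D2 v) := hcf.clm_apply continuous_const
  have hcs : Continuous fun x => Complex.normSq (v x) ^ (p - 1) :=
    (Complex.continuous_normSq.comp hv.continuous).rpow_const
      fun _ => Or.inr (by linarith)
  have hG : IntegrableOn (fun x => (‖D1 v x‖ ^ 2 + ‖D2 v x‖ ^ 2) *
      Complex.normSq (v x) ^ (p - 1)) TT := by
    refine Continuous.continuousOn ?_ |>.integrableOn_compact isCompact_Icc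
    fun_prop
  have hP : IntegrableOn (fun x => D1 (Wp p v) x * D1 v x + D2 (Wp p v) x * D2 v x) TT := by
    refine (hG.const_mul (2 * p - 1)).mono' ?_ ?_
    · refine Measurable.aestronglyMeasurable ?_
      have m1 : Measurable (D1 (Wp p v)) := measurable_fderiv_apply_const ℝ (Wp p v) _
      have m2 : Measurable (D2 (Wp p v)) := measurable_fderiv_apply_const ℝ (Wp p v) _
      exact (m1.mul hc1.measurable).add (m2.mul hc2.measurable)
    · refine Filter.Eventually.of_forall fun x => ?_
      refine (norm_add_le _ _).trans ?_
      have b1 := wform_bound p hp (v x) (D1 v x)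
      have b2 := wform_bound p hp (v x) (D2 v x)
      have e1 : D1 (Wp p v) x = wform p (v x) (D1 v x) := hW x _
      have e2 : D2 (Wp p v) x = wform p (v x) (D2 v x) := hW x _
      rw [e1, e2]
      linarith
  unfold GradTerm GradPair
  rw [← integral_const_mul, ← integral_const_mul]
  have hP' := hP.const_mul (Complex.I + (μ : ℂ))
  have hre : (∫ x in TT, (Complex.I + (μ : ℂ)) *
      (D1 (Wp p v) x * D1 v x + D2 (Wp p v) x * D2 v x)).re =
      ∫ x in TT, ((Complex.I + (μ : ℂ)) *
      (D1 (Wp p v) x * D1 v x + D2 (Wp p v) x * D2 v x)).re :=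
    (Complex.reCLM.integral_comp_comm hP').symm
  rw [hre]
  refine integral_mono (hG.const_mul _) (Complex.reCLM.integrable_comp hP') fun x => ?_
  have b1 := pointwise μ p δ hμ hp hδ1 hcond (v x) (D1 v x)
  have b2 := pointwise μ p δ hμ hp hδ1 hcond (v x) (D2 v x)
  have e1 : D1 (Wp p v) x = wform p (v x) (D1 v x) := hW x _
  have e2 : D2 (Wp p v) x = wform p (v x) (D2 v x) := hW x _
  simp only [e1, e2, mul_add (Complex.I + (μ : ℂ)), Complex.add_re (_ * _) (_ * _)]
  linarith

end
end
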